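/- For every A > 0, every d ∈ ℝ and every real λ ≠ 0, the limit lim_{R→∞} (1/(2π))·∫_{−R}^{R} [log(t²+A²) − log((t+d)²+A²)]·e^{−iλt} dt exists and equals (e^{iλd} − 1)·e^{−A|λ|}/|λ|. -/

import Mathlib

open MeasureTheory Filter Topology

noncomputable def s5h (A t : ℝ) : ℝ := 2 * (A ^ 2 - t ^ 2) / (t ^ 2 + A ^ 2) ^ 2

lemma s5_half_int (A : ℝ) (hA : 0 < A) :
    IntegrableOn (fun x : ℝ => |x| * Real.exp (-A * |x|)) (Set.Ioi 0) := by
  have h := integrableOn_rpow_mul_exp_neg_mul_rpow (p := 1) (s := 1) (b := A)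
    (by norm_num) (by norm_num) hA
  refine h.congr_fun (fun x hx => ?_) measurableSet_Ioi
  have hx' : (0 : ℝ) < x := hx
  simp [abs_of_pos hx']

lemma s5_int (A : ℝ) (hA : 0 < A) :
    Integrable (fun x : ℝ => |x| * Real.exp (-A * |x|)) := by
  have h := s5_half_int A hA
  rw [← integrableOn_univ, ← Set.Iic_union_Ioi (a := (0 : ℝ)), integrableOn_union]
  refine ⟨?_, h⟩
  rw [← Measure.map_neg_eq_self (volume : Measure ℝ)]
  let m : MeasurableEmbedding fun x : ℝ => -x := (Homeomorph.neg ℝ).measurableEmbedding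
  rw [m.integrableOn_map_iff]
  simp_rw [Function.comp_def, abs_neg, Set.neg_preimage, Set.neg_Iic, neg_zero]
  exact Iff.mpr integrableOn_Ici_iff_integrableOn_Ioi h

lemma s5_norm_exp (A t x : ℝ) :
    ‖Complex.exp (-(A + Complex.I * t) * x)‖ = Real.exp (-A * x) := by
  rw [Complex.norm_exp]; simp

lemma s5_laplace (A : ℝ) (hA : 0 < A) (t : ℝ) :
    ∫ x : ℝ in Set.Ioi 0, (x : ℂ) * Complex.exp (-(A + Complex.I * t) * x)
      = 1 / (A + Complex.I * t) ^ 2 := by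
  set z : ℂ := A + Complex.I * t with hz
  have hz0 : z ≠ 0 := by
    intro h
    have := congrArg Complex.re h
    simp [hz] at this
    exact hA.ne' this
  have hd : ∀ x ∈ Set.Ici (0 : ℝ), HasDerivAt
      (fun x : ℝ => -((x : ℂ) / z + 1 / z ^ 2) * Complex.exp (-z * x))
      ((x : ℂ) * Complex.exp (-z * x)) x := by
    intro x _
    have h1 : HasDerivAt (fun x : ℝ => (x : ℂ)) 1 x := Complex.ofRealCLM.hasDerivAt
    have h2 := (((h1.div_const z).add_const (1 / z ^ 2)).neg).mul ((h1.const_mul (-z)).cexp)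
    refine h2.congr_deriv ?_
    simp only [Pi.neg_apply]
    field_simp
    ring
  have hint : IntegrableOn (fun x : ℝ => (x : ℂ) * Complex.exp (-z * x)) (Set.Ioi 0) := by
    refine (s5_half_int A hA).mono' (by fun_prop) ?_
    filter_upwards [ae_restrict_mem measurableSet_Ioi] with x hx
    have hx' : (0 : ℝ) < x := hx
    rw [norm_mul, hz, s5_norm_exp, abs_of_pos hx', Complex.norm_real, Real.norm_eq_abs,
      abs_of_pos hx']
  have e0 : Tendsto (fun x : ℝ => Complex.exp (-z * x)) atTop (𝓝 0) := by
    rw [tendsto_zero_iff_norm_tendsto_zero]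
    simp_rw [hz, s5_norm_exp]
    simpa using tendsto_rpow_mul_exp_neg_mul_atTop_nhds_zero 0 A hA
  have e1 : Tendsto (fun x : ℝ => (x : ℂ) * Complex.exp (-z * x)) atTop (𝓝 0) := by
    rw [tendsto_zero_iff_norm_tendsto_zero]
    refine (tendsto_rpow_mul_exp_neg_mul_atTop_nhds_zero 1 A hA).congr' ?_
    filter_upwards [eventually_gt_atTop 0] with x hx
    rw [norm_mul, hz, s5_norm_exp, Complex.norm_real, Real.norm_eq_abs, abs_of_pos hx]
    simp
  have hlim : Tendsto (fun x : ℝ => -((x : ℂ) / z + 1 / z ^ 2) * Complex.exp (-z * x)) atTop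
      (𝓝 0) := by
    have := (e1.const_mul (-1 / z)).add (e0.const_mul (-1 / z ^ 2))
    simp only [mul_zero, add_zero] at this
    refine this.congr (fun x => ?_)
    ring
  rw [integral_Ioi_of_hasDerivAt_of_tendsto' hd hint hlim]
  simp

lemma s5_fourier (A : ℝ) (hA : 0 < A) (t : ℝ) :
    ∫ x : ℝ, Complex.exp (-(Complex.I * t * x)) * ((|x| * Real.exp (-A * |x|) : ℝ) : ℂ)
      = (s5h A t : ℂ) := by
  have hint : Integrable (fun x : ℝ =>
      Complex.exp (-(Complex.I * t * x)) * ((|x| * Real.exp (-A * |x|) : ℝ) : ℂ)) := by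
    refine (s5_int A hA).mono' (by fun_prop) (ae_of_all _ fun x => ?_)
    rw [norm_mul, Complex.norm_exp, Complex.norm_real, Real.norm_eq_abs, abs_of_nonneg (by positivity)]
    simp
  rw [← intervalIntegral.integral_Iic_add_Ioi (b := 0) hint.integrableOn hint.integrableOn]
  have e1 : ∫ x : ℝ in Set.Ioi 0,
      Complex.exp (-(Complex.I * t * x)) * ((|x| * Real.exp (-A * |x|) : ℝ) : ℂ)
      = 1 / (A + Complex.I * t) ^ 2 := by
    rw [← s5_laplace A hA t]
    refine setIntegral_congr_fun measurableSet_Ioi fun x hx => ?_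
    have hx' : (0 : ℝ) < x := hx
    simp only [abs_of_pos hx']
    push_cast
    rw [mul_left_comm, ← Complex.exp_add]
    congr 2; ring
  have e2 : ∫ x : ℝ in Set.Iic 0,
      Complex.exp (-(Complex.I * t * x)) * ((|x| * Real.exp (-A * |x|) : ℝ) : ℂ)
      = 1 / (A + Complex.I * (-t : ℝ)) ^ 2 := by
    rw [← s5_laplace A hA (-t)]
    have := integral_comp_neg_Ioi 0 (fun x : ℝ =>
      Complex.exp (-(Complex.I * t * x)) * ((|x| * Real.exp (-A * |x|) : ℝ) : ℂ))
    rw [neg_zero] at this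
    rw [← this]
    refine setIntegral_congr_fun measurableSet_Ioi fun x hx => ?_
    have hx' : (0 : ℝ) < x := hx
    simp only [abs_neg, abs_of_pos hx']
    push_cast
    rw [mul_left_comm, ← Complex.exp_add]
    congr 2; ring
  rw [e1, e2, s5h]
  have h1 : (A : ℂ) + Complex.I * t ≠ 0 := by
    intro h
    have := congrArg Complex.re h
    simp at this
    exact hA.ne' this
  have h2 : (A : ℂ) - Complex.I * t ≠ 0 := by
    intro h
    have := congrArg Complex.re h
    simp at this
    exact hA.ne' this
  have h3 : ((t : ℂ) ^ 2 + A ^ 2) = (A + Complex.I * t) * (A - Complex.I * t) := by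
    linear_combination (t : ℂ) ^ 2 * Complex.I_sq
  push_cast
  rw [h3, mul_neg, ← sub_eq_add_neg]
  field_simp
  linear_combination 2 * (t : ℂ) ^ 2 * Complex.I_sq

lemma s5_h_cont (A : ℝ) (hA : 0 < A) : Continuous (s5h A) := by
  unfold s5h
  refine Continuous.div (by fun_prop) (by fun_prop) fun t => by positivity

lemma s5_h_int (A : ℝ) (hA : 0 < A) : Integrable (s5h A) := by
  refine (integrable_inv_one_add_sq.const_mul (2 * (1 + 1 / A ^ 2))).mono'
    (s5_h_cont A hA).aestronglyMeasurable (ae_of_all _ fun t => ?_)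
  rw [Real.norm_eq_abs, s5h, abs_div, abs_of_pos (show 0 < (t ^ 2 + A ^ 2) ^ 2 by positivity),
    abs_mul, abs_two]
  have h1 : |A ^ 2 - t ^ 2| ≤ t ^ 2 + A ^ 2 := by
    rw [abs_le]; constructor <;> nlinarith [sq_nonneg t, sq_nonneg A]
  calc 2 * |A ^ 2 - t ^ 2| / (t ^ 2 + A ^ 2) ^ 2 ≤ 2 * (t ^ 2 + A ^ 2) / (t ^ 2 + A ^ 2) ^ 2 := by
        gcongr
    _ = 2 / (t ^ 2 + A ^ 2) := by field_simp
    _ ≤ 2 * (1 + 1 / A ^ 2) * (1 + t ^ 2)⁻¹ := by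
        rw [← div_eq_mul_inv, div_le_div_iff₀ (by positivity) (by positivity)]
        have : 2 * (1 + 1 / A ^ 2) * (t ^ 2 + A ^ 2)
          = 2 * (1 + t ^ 2) + 2 * (A ^ 2 + t ^ 2 / A ^ 2) := by field_simp; ring
        rw [this]
        have : 0 ≤ 2 * (A ^ 2 + t ^ 2 / A ^ 2) := by positivity
        linarith

open FourierTransform in
lemma s5_inv (A : ℝ) (hA : 0 < A) (lam : ℝ) :
    ∫ t : ℝ, (s5h A t : ℂ) * Complex.exp (-Complex.I * lam * t)
      = 2 * Real.pi * ((|lam| * Real.exp (-A * |lam|) : ℝ) : ℂ) := by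
  set f : ℝ → ℂ := fun x => ((|x| * Real.exp (-A * |x|) : ℝ) : ℂ) with hf
  have hF : 𝓕 f = fun w : ℝ => (s5h A (2 * Real.pi * w) : ℂ) := by
    ext w
    rw [Real.fourier_eq', ← s5_fourier A hA]
    refine integral_congr_ae (ae_of_all _ fun x => ?_)
    simp only [smul_eq_mul, hf, RCLike.inner_apply, conj_trivial]
    congr 2
    push_cast; ring
  have hc : Continuous f := by fun_prop
  have hi : Integrable f := (s5_int A hA).ofReal
  have hFi : Integrable (𝓕 f) := by
    rw [hF]
    exact ((s5_h_int A hA).comp_mul_left' (by positivity)).ofReal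
  have key := congrFun (hc.fourierInv_fourier_eq hi hFi) (-lam)
  rw [Real.fourierInv_eq', hF] at key
  have h2 := Measure.integral_comp_mul_left
    (fun t : ℝ => (s5h A t : ℂ) * Complex.exp (-Complex.I * lam * t)) (2 * Real.pi)
  have h3 : ∫ w : ℝ, (s5h A (2 * Real.pi * w) : ℂ) *
      Complex.exp (-Complex.I * lam * (2 * Real.pi * w : ℝ)) = f (-lam) := by
    rw [← key]
    refine integral_congr_ae (ae_of_all _ fun x => ?_)
    simp only [smul_eq_mul, RCLike.inner_apply, conj_trivial]
    rw [mul_comm]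
    congr 2
    push_cast; ring
  rw [h3] at h2
  have hp : (Real.pi : ℂ) ≠ 0 := by exact_mod_cast Real.pi_ne_zero
  rw [abs_of_pos (by positivity), Complex.real_smul] at h2
  simp only [hf, abs_neg] at h2
  rw [h2]
  push_cast
  field_simp

noncomputable def s5g (A t : ℝ) : ℝ := 2 * t / (t ^ 2 + A ^ 2)

lemma s5_log_deriv (A : ℝ) (hA : 0 < A) (t : ℝ) :
    HasDerivAt (fun t : ℝ => Real.log (t ^ 2 + A ^ 2)) (s5g A t) t := by
  have h := (((hasDerivAt_id t).pow 2).add_const (A ^ 2)).log (by simp; positivity)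
  refine h.congr_deriv ?_
  simp [s5g]

lemma s5_g_deriv (A : ℝ) (hA : 0 < A) (t : ℝ) :
    HasDerivAt (s5g A) (s5h A t) t := by
  have h := ((hasDerivAt_id t).const_mul 2).div (((hasDerivAt_id t).pow 2).add_const (A ^ 2))
    (by simp; positivity)
  refine h.congr_deriv ?_
  simp [s5h]
  ring

lemma s5_g_lim (A : ℝ) {l : Filter ℝ} {u : ℝ → ℝ} (hu : Tendsto (fun t => |u t|) l atTop) :
    Tendsto (fun t => s5g A (u t)) l (𝓝 0) := by
  refine squeeze_zero_norm' (a := fun t => 2 / |u t|) ?_ (hu.const_div_atTop 2)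
  filter_upwards [hu.eventually_gt_atTop 0] with t ht
  have : 0 < u t ^ 2 := by rw [← sq_abs]; positivity
  rw [Real.norm_eq_abs, s5g, abs_div, abs_of_pos (by positivity : 0 < u t ^ 2 + A ^ 2), abs_mul,
    abs_two, div_le_div_iff₀ (by positivity) ht]
  nlinarith [sq_abs (u t), sq_nonneg A]

lemma s5_inv_lim (A : ℝ) {l : Filter ℝ} {u : ℝ → ℝ} (hu : Tendsto (fun t => |u t|) l atTop) :
    Tendsto (fun t => 1 / (u t ^ 2 + A ^ 2)) l (𝓝 0) := by
  have h : Tendsto (fun t => u t ^ 2 + A ^ 2) l atTop := by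
    have := (tendsto_pow_atTop (two_ne_zero)).comp hu
    refine tendsto_atTop_add_const_right _ _ (this.congr fun t => ?_)
    simp
  exact h.const_div_atTop 1

lemma s5_psi_lim (A : ℝ) (hA : 0 < A) (d : ℝ) {l : Filter ℝ}
    (hu : Tendsto (fun t => |t + d|) l atTop) :
    Tendsto (fun t => Real.log (t ^ 2 + A ^ 2) - Real.log ((t + d) ^ 2 + A ^ 2)) l (𝓝 0) := by
  have h := (((s5_g_lim A hu).const_mul (-d)).add ((s5_inv_lim A hu).const_mul (d ^ 2))).const_add 1
  simp only [mul_zero, add_zero] at h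
  have h2 := h.log one_ne_zero
  rw [Real.log_one] at h2
  refine h2.congr fun t => ?_
  rw [← Real.log_div (by positivity) (by positivity)]
  congr 1
  have : (t + d) ^ 2 + A ^ 2 ≠ 0 := by positivity
  rw [s5g]
  field_simp
  ring

/-- the symmetric improper Fourier integral of
`ψ(t) = log(t²+A²) − log((t+d)²+A²)` (with normalization `(1/2π)∫ψ(t)e^{−iλt}dt`)
converges and equals `(e^{iλd} − 1)·e^{−A|λ|}/|λ|` for `λ ≠ 0`. -/
theorem stmt_5 (A d lam : ℝ) (hA : 0 < A) (hlam : lam ≠ 0) :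
    Tendsto (fun R : ℝ =>
        (1 / (2 * (Real.pi : ℂ))) *
          ∫ t in (-R)..R,
            ((Real.log (t ^ 2 + A ^ 2) - Real.log ((t + d) ^ 2 + A ^ 2) : ℝ) : ℂ) *
              Complex.exp (-Complex.I * lam * t))
      atTop
      (𝓝 ((Complex.exp (Complex.I * lam * d) - 1) *
        ((Real.exp (-A * |lam|) : ℝ) : ℂ) / ((|lam| : ℝ) : ℂ))) := by
  have hlc : (lam : ℂ) ≠ 0 := by exact_mod_cast hlam
  have hp : (Real.pi : ℂ) ≠ 0 := by exact_mod_cast Real.pi_ne_zero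
  set psi : ℝ → ℝ := fun t => Real.log (t ^ 2 + A ^ 2) - Real.log ((t + d) ^ 2 + A ^ 2) with hpsi
  set psi1 : ℝ → ℝ := fun t => s5g A t - s5g A (t + d) with hpsi1
  set psi2 : ℝ → ℝ := fun t => s5h A t - s5h A (t + d) with hpsi2
  set e : ℝ → ℂ := fun t => Complex.exp (-Complex.I * lam * t) with he
  have hen : ∀ t, ‖e t‖ = 1 := by
    intro t; simp only [he]; rw [Complex.norm_exp]; simp
  have hec : Continuous e := by fun_prop
  have d1 : ∀ t, HasDerivAt psi (psi1 t) t := fun t =>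
    (s5_log_deriv A hA t).sub ((s5_log_deriv A hA (t + d)).comp_add_const t d)
  have d2 : ∀ t, HasDerivAt psi1 (psi2 t) t := fun t =>
    (s5_g_deriv A hA t).sub ((s5_g_deriv A hA (t + d)).comp_add_const t d)
  have hpsic : Continuous psi := continuous_iff_continuousAt.2 fun t => (d1 t).continuousAt
  have hpsi2c : Continuous psi2 := by
    have := s5_h_cont A hA
    fun_prop
  have de : ∀ t, HasDerivAt e (-Complex.I * lam * e t) t := by
    intro t
    have h1 : HasDerivAt (fun x : ℝ => (x : ℂ)) 1 t := Complex.ofRealCLM.hasDerivAt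
    refine ((h1.const_mul (-Complex.I * lam)).cexp).congr_deriv ?_
    simp only [he]; ring
  set F : ℝ → ℂ := fun t => (Complex.I / lam * psi t + 1 / lam ^ 2 * psi1 t) * e t with hF
  have dF : ∀ t, HasDerivAt F (psi t * e t + 1 / lam ^ 2 * (psi2 t * e t)) t := by
    intro t
    have h := ((((d1 t).ofReal_comp).const_mul (Complex.I / lam)).add
      (((d2 t).ofReal_comp).const_mul (1 / (lam : ℂ) ^ 2))).mul (de t)
    refine h.congr_deriv ?_
    simp only [Pi.add_apply]
    field_simp
    linear_combination (-(lam : ℂ) ^ 2 * psi t * e t) * Complex.I_sq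
  have hFlim : ∀ l : Filter ℝ, (∀ c : ℝ, Tendsto (fun t => |t + c|) l atTop) →
      Tendsto F l (𝓝 0) := by
    intro l hl
    have a1 : Tendsto psi l (𝓝 0) := s5_psi_lim A hA d (hl d)
    have a2 : Tendsto psi1 l (𝓝 0) := by
      have b1 := s5_g_lim A (u := fun t => t) (by simpa using hl 0)
      simpa using b1.sub (s5_g_lim A (hl d))
    have a3 : Tendsto (fun t => Complex.I / lam * (psi t : ℂ) + 1 / lam ^ 2 * (psi1 t : ℂ)) l
        (𝓝 0) := by
      have := (a1.ofReal.const_mul (Complex.I / lam)).add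
        (a2.ofReal.const_mul (1 / (lam : ℂ) ^ 2))
      simpa using this
    rw [tendsto_zero_iff_norm_tendsto_zero] at a3 ⊢
    refine a3.congr fun t => ?_
    simp only [hF, norm_mul, hen, mul_one]
  have hFtop : Tendsto F atTop (𝓝 0) := hFlim _ fun c =>
    tendsto_abs_atTop_atTop.comp (tendsto_atTop_add_const_right _ c tendsto_id)
  have hFbot : Tendsto F atBot (𝓝 0) := hFlim _ fun c =>
    tendsto_abs_atBot_atTop.comp (tendsto_atBot_add_const_right _ c tendsto_id)
  have hhe : Integrable (fun t => (s5h A t : ℂ) * e t) := by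
    refine (s5_h_int A hA).norm.mono' ?_ (ae_of_all _ fun t => ?_)
    · have := s5_h_cont A hA
      exact Continuous.aestronglyMeasurable (by fun_prop)
    · rw [norm_mul, hen, mul_one, Complex.norm_real]
  have hsh : ∀ t, (psi2 t : ℂ) * e t = (s5h A t : ℂ) * e t -
      Complex.exp (Complex.I * lam * d) * ((s5h A (t + d) : ℂ) * e (t + d)) := by
    intro t
    have : e t = Complex.exp (Complex.I * lam * d) * e (t + d) := by
      simp only [he]; rw [← Complex.exp_add]; congr 1; push_cast; ring
    simp only [hpsi2]; push_cast
    linear_combination (-(s5h A (t + d) : ℂ)) * this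
  have hi2 : Integrable (fun t => (psi2 t : ℂ) * e t) := by
    simp_rw [hsh]
    exact hhe.sub ((hhe.comp_add_right d).const_mul _)
  have hv2 : ∫ t, (psi2 t : ℂ) * e t = (1 - Complex.exp (Complex.I * lam * d)) *
      (2 * Real.pi * ((|lam| * Real.exp (-A * |lam|) : ℝ) : ℂ)) := by
    simp_rw [hsh]
    rw [integral_sub hhe ((hhe.comp_add_right d).const_mul _), integral_const_mul,
      integral_add_right_eq_self (fun t => (s5h A t : ℂ) * e t) d, s5_inv A hA lam]
    ring
  have hI : ∀ R : ℝ, ∫ t in (-R)..R, (psi t : ℂ) * e t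
      = F R - F (-R) - 1 / lam ^ 2 * ∫ t in (-R)..R, (psi2 t : ℂ) * e t := by
    intro R
    have c1 : Continuous fun t => (psi t : ℂ) * e t := by fun_prop
    have c2 : Continuous fun t => 1 / (lam : ℂ) ^ 2 * ((psi2 t : ℂ) * e t) := by fun_prop
    have h := intervalIntegral.integral_eq_sub_of_hasDerivAt (a := -R) (b := R)
      (fun t _ => dF t) ((c1.add c2).intervalIntegrable _ _)
    rw [intervalIntegral.integral_add (c1.intervalIntegrable _ _) (c2.intervalIntegrable _ _),
      intervalIntegral.integral_const_mul] at h
    rw [← h]; ring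
  have hlim := ((hFtop.sub (hFbot.comp tendsto_neg_atTop_atBot)).sub
    ((intervalIntegral_tendsto_integral hi2 tendsto_neg_atTop_atBot tendsto_id).const_mul
      (1 / (lam : ℂ) ^ 2))).const_mul (1 / (2 * (Real.pi : ℂ)))
  rw [hv2] at hlim
  have hval : (1 / (2 * (Real.pi : ℂ))) * (0 - 0 - 1 / (lam : ℂ) ^ 2 *
      ((1 - Complex.exp (Complex.I * lam * d)) *
      (2 * Real.pi * ((|lam| * Real.exp (-A * |lam|) : ℝ) : ℂ))))
      = (Complex.exp (Complex.I * lam * d) - 1) *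
        ((Real.exp (-A * |lam|) : ℝ) : ℂ) / ((|lam| : ℝ) : ℂ) := by
    have hsq : (lam : ℂ) ^ 2 = ((|lam| : ℝ) : ℂ) ^ 2 := by
      exact_mod_cast (sq_abs lam).symm
    have hab : ((|lam| : ℝ) : ℂ) ≠ 0 := by exact_mod_cast abs_ne_zero.2 hlam
    rw [hsq, Complex.ofReal_mul]
    field_simp
    ring
  rw [hval] at hlim
  refine hlim.congr fun R => ?_
  rw [hI R]
  rfl
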